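/- Product bound for ite subfunctions: for Boolean functions F, G, H on n variables and every k, the number of distinct level-k subfunctions of ite(F,G,H) is at most the product of the numbers of distinct level-k subfunctions of F, G and H: |Sub_k(ite F G H)| ≤ |Sub_k(F)| · |Sub_k(G)| · |Sub_k(H)|. (This is the semantic content of the polynomial worst-case bound O(|F|·|G|·|H|) of the ite algorithm on BDDs.) -/

import Mathlib

/-- The if-then-else operator on Boolean functions. -/
def bIte {n : ℕ} (F G H : (Fin n → Bool) → Bool) : (Fin n → Bool) → Bool :=
  fun v => cond (F v) (G v) (H v)

/-- The set of level-`k` subfunctions of `f`: all functions obtained from `f`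
by fixing the variables `x_j` with `j < k` to constants. -/
def subFuns {n : ℕ} (k : ℕ) (f : (Fin n → Bool) → Bool) : Set ((Fin n → Bool) → Bool) :=
  {p | ∃ ρ : Fin n → Bool, p = fun v => f (fun j => if (j : ℕ) < k then ρ j else v j)}

/-- Every subfunction of `bIte F G H` is the `bIte` of subfunctions of `F`, `G` and `H`. -/
theorem subFuns_bIte_subset {n : ℕ} (k : ℕ) (F G H : (Fin n → Bool) → Bool) :
    subFuns k (bIte F G H) ⊆
      (fun p => bIte p.1.1 p.1.2 p.2) '' ((subFuns k F ×ˢ subFuns k G) ×ˢ subFuns k H) := by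
  rintro _ ⟨ρ, rfl⟩
  exact ⟨((_, _), _), ⟨⟨⟨ρ, rfl⟩, ⟨ρ, rfl⟩⟩, ⟨ρ, rfl⟩⟩, rfl⟩

theorem ite_subfunction_product_bound (n : ℕ) (F G H : (Fin n → Bool) → Bool) (k : ℕ) :
    (subFuns k (bIte F G H)).ncard ≤ (subFuns k F).ncard * (subFuns k G).ncard * (subFuns k H).ncard := by
  rw [← Set.ncard_prod, ← Set.ncard_prod]
  exact (Set.ncard_le_ncard (subFuns_bIte_subset k F G H) (Set.toFinite _)).trans
    (Set.ncard_image_le (Set.toFinite _))
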